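/- The Tessera curve space (X_T, d, Λ) satisfies the relative layer decay property (RLD): for every 0 < α < 1 there is a constant C < ∞ such that for every ball B = B(z,r) in X_T, every ball B(w,R) in X_T with R ≤ 2r, and every ε > 0, Λ(B_ε ∩ B(w,R)) ≤ C (ε/R)^α Λ(B(w,R)). -/

import Mathlib

open MeasureTheory Metric Set
open scoped ENNReal NNReal Real

/-- The trace `X = γ([0,∞))` of a curve `γ : [0,∞) → ℂ`. -/
def curveSet (γ : ℝ → ℂ) : Set ℂ := γ '' Set.Ici 0

/-- The union `B_ε` of the inner and outer layers of width `ε` of the "ball"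
`S ∩ B` of the subspace `S`, complements being taken in `S`. -/
def relLayer (S B : Set ℂ) (ε : ℝ) : Set ℂ :=
  {x ∈ S ∩ B | Metric.infDist x (S \ B) ≤ ε} ∪
  {y ∈ S \ B | Metric.infDist y (S ∩ B) ≤ ε}

/-- A well-behaved piece of the space. -/
structure TGood (X P : Set ℂ) (l : ℝ) (g : ℝ → ℂ) : Prop where
  img : P = g '' Icc 0 l
  nonneg : 0 ≤ l
  lip : ∀ s ∈ Icc 0 l, ∀ t ∈ Icc 0 l, dist (g s) (g t) ≤ |s - t|
  colip : ∀ s ∈ Icc 0 l, ∀ t ∈ Icc 0 l, |s - t| ≤ 2 * dist (g s) (g t)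
  sep : ∀ s ∈ Icc 0 l, ∀ y ∈ X, y ∉ P →
    dist (g s) (g 0) ≤ 4 * dist (g s) y ∨ dist (g s) (g l) ≤ 4 * dist (g s) y
  ord : ∀ z : ℂ, ∀ r : ℝ, 0 < r → OrdConnected {s | s ∈ Icc 0 l ∧ g s ∈ ball z r} ∨
    OrdConnected {s | s ∈ Icc 0 l ∧ g s ∉ ball z r}

lemma TGood.measure_image {X P : Set ℂ} {l : ℝ} {g : ℝ → ℂ} (h : TGood X P l g)
    {A : Set ℝ} (hA : A ⊆ Icc 0 l) : μH[1] (g '' A) ≤ volume A := by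
  have hL : LipschitzOnWith 1 g A := by
    apply LipschitzOnWith.of_dist_le_mul
    intro s hs t ht
    simpa [Real.dist_eq] using h.lip s (hA hs) t (hA ht)
  have := hL.hausdorffMeasure_image_le (d := 1) zero_le_one
  simpa [hausdorffMeasure_real] using this

lemma tord_aux {U : Set ℝ} {l s t d : ℝ} (hU : U.OrdConnected) (hl : U ⊆ Icc 0 l)
    (hs : s ∈ U) (ht : t ∉ U) (hd : |s - t| ≤ d) :
    (|s - sInf U| ≤ d ∧ |t - sInf U| ≤ d) ∨ (|s - sSup U| ≤ d ∧ |t - sSup U| ≤ d) := by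
  have hb : BddBelow U := ⟨0, fun x hx => (hl hx).1⟩
  have ha : BddAbove U := ⟨l, fun x hx => (hl hx).2⟩
  have h1 := csInf_le hb hs
  have h2 := le_csSup ha hs
  rw [abs_le] at hd
  rcases lt_or_ge t s with hts | hts
  · left
    have : t ≤ sInf U := by
      apply le_csInf ⟨s, hs⟩
      intro u hu
      by_contra hc
      push Not at hc
      exact ht (hU.out hu hs ⟨hc.le, hts.le⟩)
    constructor <;> rw [abs_le] <;> constructor <;> linarith
  · right
    have : sSup U ≤ t := by
      apply csSup_le ⟨s, hs⟩
      intro u hu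
      by_contra hc
      push Not at hc
      exact ht (hU.out hs hu ⟨hts, hc.le⟩)
    constructor <;> rw [abs_le] <;> constructor <;> linarith

lemma relLayer_exists {X : Set ℂ} {z x : ℂ} {r ε : ℝ} (hz : z ∈ X) (hr : 0 < r)
    (hX : ∀ M : ℝ, ∃ y ∈ X, M ≤ dist y z) (he : 0 < ε)
    (hx : x ∈ relLayer X (ball z r) ε) :
    ∃ y ∈ X, dist x y ≤ 2 * ε ∧
      ((x ∈ ball z r ∧ y ∉ ball z r) ∨ (x ∉ ball z r ∧ y ∈ ball z r)) := by
  rcases hx with ⟨⟨h1, h2⟩, h3⟩ | ⟨⟨h1, h2⟩, h3⟩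
  · have hne : (X \ ball z r).Nonempty := by
      obtain ⟨y, hy, h⟩ := hX r
      exact ⟨y, hy, by simpa [mem_ball] using h⟩
    obtain ⟨y, hy, h⟩ := (infDist_lt_iff hne).1 (lt_of_le_of_lt h3 (by linarith : ε < 2 * ε))
    exact ⟨y, hy.1, h.le, Or.inl ⟨h2, hy.2⟩⟩
  · have hne : (X ∩ ball z r).Nonempty := ⟨z, hz, mem_ball_self hr⟩
    obtain ⟨y, hy, h⟩ := (infDist_lt_iff hne).1 (lt_of_le_of_lt h3 (by linarith : ε < 2 * ε))
    exact ⟨y, hy.1, h.le, Or.inr ⟨h2, hy.2⟩⟩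

lemma TGood.layer {X P : Set ℂ} {l : ℝ} {g : ℝ → ℂ} (h : TGood X P l g)
    {z : ℂ} {r ε : ℝ} (hz : z ∈ X) (hr : 0 < r)
    (hX : ∀ M : ℝ, ∃ y ∈ X, M ≤ dist y z) (he : 0 < ε) :
    μH[1] (relLayer X (ball z r) ε ∩ P) ≤ ENNReal.ofReal (80 * ε) := by
  obtain ⟨a, b, hab⟩ : ∃ a b : ℝ, ∀ s ∈ Icc 0 l, ∀ t ∈ Icc 0 l, |s - t| ≤ 4 * ε →
      ((g s ∈ ball z r ∧ g t ∉ ball z r) ∨ (g s ∉ ball z r ∧ g t ∈ ball z r)) →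
      |s - a| ≤ 4 * ε ∨ |s - b| ≤ 4 * ε := by
    rcases h.ord z r hr with hU | hU
    · refine ⟨sInf {s | s ∈ Icc 0 l ∧ g s ∈ ball z r}, sSup {s | s ∈ Icc 0 l ∧ g s ∈ ball z r},
        fun s hs t ht hd hc => ?_⟩
      · rcases hc with ⟨h1, h2⟩ | ⟨h1, h2⟩
        · rcases tord_aux hU (fun x hx => hx.1) (s := s) (t := t) ⟨hs, h1⟩ (fun hh => h2 hh.2) hd
            with hh | hh
          · exact Or.inl hh.1
          · exact Or.inr hh.1
        · rw [abs_sub_comm] at hd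
          rcases tord_aux hU (fun x hx => hx.1) (s := t) (t := s) ⟨ht, h2⟩ (fun hh => h1 hh.2) hd
            with hh | hh
          · exact Or.inl hh.2
          · exact Or.inr hh.2
    · refine ⟨sInf {s | s ∈ Icc 0 l ∧ g s ∉ ball z r}, sSup {s | s ∈ Icc 0 l ∧ g s ∉ ball z r},
        fun s hs t ht hd hc => ?_⟩
      · rcases hc with ⟨h1, h2⟩ | ⟨h1, h2⟩
        · rw [abs_sub_comm] at hd
          rcases tord_aux hU (fun x hx => hx.1) (s := t) (t := s) ⟨ht, h2⟩ (fun hh => hh.2 h1) hd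
            with hh | hh
          · exact Or.inl hh.2
          · exact Or.inr hh.2
        · rcases tord_aux hU (fun x hx => hx.1) (s := s) (t := t) ⟨hs, h1⟩ (fun hh => hh.2 h2) hd
            with hh | hh
          · exact Or.inl hh.1
          · exact Or.inr hh.1
  set V : Set ℝ := (closedBall a (4 * ε) ∪ closedBall b (4 * ε)) ∪
    (closedBall 0 (16 * ε) ∪ closedBall l (16 * ε)) with hV
  have hsub : relLayer X (ball z r) ε ∩ P ⊆ g '' (V ∩ Icc 0 l) := by
    rintro x ⟨hx, hxP⟩
    obtain ⟨y, hy, hxy, hc⟩ := relLayer_exists hz hr hX he hx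
    have hxP' := hxP
    rw [h.img] at hxP'
    obtain ⟨s, hs, rfl⟩ := hxP'
    refine ⟨s, ⟨?_, hs⟩, rfl⟩
    simp only [hV, mem_union, mem_closedBall, Real.dist_eq]
    by_cases hyP : y ∈ P
    · left
      rw [h.img] at hyP
      obtain ⟨t, ht, rfl⟩ := hyP
      exact hab s hs t ht (by linarith [h.colip s hs t ht]) hc
    · right
      rcases h.sep s hs y hy hyP with hh | hh
      · left; linarith [h.colip s hs 0 ⟨le_rfl, h.nonneg⟩]
      · right; linarith [h.colip s hs l ⟨h.nonneg, le_rfl⟩]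
  calc _ ≤ μH[1] (g '' (V ∩ Icc 0 l)) := measure_mono hsub
    _ ≤ volume (V ∩ Icc 0 l) := h.measure_image inter_subset_right
    _ ≤ volume V := measure_mono inter_subset_left
    _ ≤ (volume (closedBall a (4 * ε)) + volume (closedBall b (4 * ε))) +
        (volume (closedBall (0:ℝ) (16 * ε)) + volume (closedBall l (16 * ε))) :=
      (measure_union_le _ _).trans (add_le_add (measure_union_le _ _) (measure_union_le _ _))
    _ = _ := by
      simp only [Real.volume_closedBall]
      rw [← ENNReal.ofReal_add, ← ENNReal.ofReal_add, ← ENNReal.ofReal_add] <;> try positivity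
      congr 1; ring

lemma TGood.ballm {X P : Set ℂ} {l : ℝ} {g : ℝ → ℂ} (h : TGood X P l g) (w : ℂ) (R : ℝ) :
    μH[1] (P ∩ ball w R) ≤ ENNReal.ofReal (8 * R) := by
  rcases (P ∩ ball w R).eq_empty_or_nonempty with he | ⟨x, hxP, hx⟩
  · simp [he]
  rw [h.img] at hxP
  obtain ⟨s, hs, rfl⟩ := hxP
  have hsub : P ∩ ball w R ⊆ g '' (closedBall s (4 * R) ∩ Icc 0 l) := by
    rintro y ⟨hyP, hy⟩
    rw [h.img] at hyP
    obtain ⟨t, ht, rfl⟩ := hyP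
    refine ⟨t, ⟨?_, ht⟩, rfl⟩
    rw [mem_closedBall, Real.dist_eq]
    have := h.colip t ht s hs
    have := dist_triangle_right (g t) (g s) w
    rw [mem_ball] at hx hy
    linarith
  calc _ ≤ μH[1] (g '' (closedBall s (4 * R) ∩ Icc 0 l)) := measure_mono hsub
    _ ≤ volume (closedBall s (4 * R) ∩ Icc 0 l) := h.measure_image inter_subset_right
    _ ≤ volume (closedBall s (4 * R)) := measure_mono inter_subset_left
    _ = _ := by
      simp only [Real.volume_closedBall]
      congr 1; ring

lemma TGood.total {X P : Set ℂ} {l : ℝ} {g : ℝ → ℂ} (h : TGood X P l g) :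
    μH[1] P ≤ ENNReal.ofReal l := by
  rw [h.img]
  refine (h.measure_image le_rfl).trans ?_
  simp

/-- sign of the k-th piece -/
noncomputable def tsg (k : ℕ) : ℝ := if Even k then 1 else -1
/-- inner radius of the k-th piece -/
noncomputable def tav (k : ℕ) : ℝ := if k = 0 then 0 else 2 ^ (k - 1)
/-- the k-th segment -/
noncomputable def tsegF (k : ℕ) (s : ℝ) : ℂ := ((tsg k * (tav k + s) : ℝ) : ℂ)
/-- the k-th arc -/
noncomputable def tarcF (k : ℕ) (s : ℝ) : ℂ :=
  ((tsg k * 2 ^ k : ℝ) : ℂ) * Complex.exp (Complex.I * ((s / 2 ^ k : ℝ) : ℂ))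
/-- the k-th segment -/
noncomputable def tSeg (k : ℕ) : Set ℂ := tsegF k '' Icc 0 (2 ^ k - tav k)
/-- the k-th arc -/
noncomputable def tArc (k : ℕ) : Set ℂ := tarcF k '' Icc 0 (π * 2 ^ k)
/-- the whole space -/
noncomputable def tX : Set ℂ := ⋃ k, (tSeg k ∪ tArc k)

lemma tsg_abs (k : ℕ) : |tsg k| = 1 := by unfold tsg; split_ifs <;> simp
lemma tsg_sq (k : ℕ) : tsg k ^ 2 = 1 := by unfold tsg; split_ifs <;> simp
lemma tsg_succ (k : ℕ) : tsg (k + 1) = - tsg k := by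
  unfold tsg; by_cases h : Even k <;> simp [h, Nat.even_add_one]
lemma tav_succ (k : ℕ) : tav (k + 1) = 2 ^ k := by simp [tav]
lemma tav_nonneg (k : ℕ) : 0 ≤ tav k := by unfold tav; split_ifs <;> positivity
lemma tav_le (k : ℕ) : tav k ≤ 2 ^ k := by
  cases k with
  | zero => simp [tav]
  | succ k => rw [tav_succ]; gcongr <;> simp
lemma tav_half (k : ℕ) : 2 ^ k ≤ 2 * tav k ∨ k = 0 := by
  cases k with
  | zero => simp
  | succ k => left; rw [tav_succ, pow_succ]; linarith
lemma tlt_av {j k : ℕ} (h : j < k) : (2:ℝ) ^ j ≤ tav k := by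
  obtain ⟨i, rfl⟩ := Nat.exists_eq_add_of_lt h
  rw [tav_succ]; gcongr <;> simp

lemma tseg_norm {k : ℕ} {s : ℝ} (hs : 0 ≤ s) : ‖tsegF k s‖ = tav k + s := by
  rw [tsegF, Complex.norm_real, Real.norm_eq_abs, abs_mul, tsg_abs, one_mul, abs_of_nonneg]
  linarith [tav_nonneg k]

lemma tarc_norm (k : ℕ) (s : ℝ) : ‖tarcF k s‖ = 2 ^ k := by
  rw [tarcF, norm_mul, Complex.norm_exp_I_mul_ofReal, Complex.norm_real, Real.norm_eq_abs, abs_mul,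
    tsg_abs]
  simp

lemma tSeg_norm {k : ℕ} {y : ℂ} (hy : y ∈ tSeg k) : tav k ≤ ‖y‖ ∧ ‖y‖ ≤ 2 ^ k := by
  obtain ⟨s, hs, rfl⟩ := hy
  rw [tseg_norm hs.1]
  constructor <;> linarith [hs.1, hs.2]

lemma tArc_norm {k : ℕ} {y : ℂ} (hy : y ∈ tArc k) : ‖y‖ = 2 ^ k := by
  obtain ⟨s, hs, rfl⟩ := hy
  exact tarc_norm k s

lemma tpiece_norm {k : ℕ} {y : ℂ} (hy : y ∈ tSeg k ∪ tArc k) : tav k ≤ ‖y‖ ∧ ‖y‖ ≤ 2 ^ k := by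
  rcases hy with hy | hy
  · exact tSeg_norm hy
  · rw [tArc_norm hy]; exact ⟨tav_le k, le_rfl⟩

lemma tseg_dist (k : ℕ) (s t : ℝ) : dist (tsegF k s) (tsegF k t) = |s - t| := by
  rw [tsegF, tsegF, Complex.dist_of_im_eq (by simp)]
  simp only [Complex.ofReal_re, Real.dist_eq]
  rw [show tsg k * (tav k + s) - tsg k * (tav k + t) = tsg k * (s - t) by ring, abs_mul, tsg_abs,
    one_mul]

lemma tseg_good (k : ℕ) : TGood tX (tSeg k) (2 ^ k - tav k) (tsegF k) where
  img := rfl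
  nonneg := by linarith [tav_le k]
  lip s _ t _ := (tseg_dist k s t).le
  colip s _ t _ := by rw [tseg_dist]; linarith [abs_nonneg (s - t)]
  sep s hs y hy hyP := by
    rw [tseg_dist, tseg_dist]
    have hd : |‖tsegF k s‖ - ‖y‖| ≤ dist (tsegF k s) y := by
      rw [dist_eq_norm]; exact abs_norm_sub_norm_le _ _
    rw [tseg_norm hs.1, abs_le] at hd
    have hy' : ‖y‖ ≤ tav k ∨ 2 ^ k ≤ ‖y‖ := by
      obtain ⟨j, hj⟩ := mem_iUnion.1 hy
      rcases lt_trichotomy j k with h | h | h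
      · left; exact (tpiece_norm hj).2.trans (tlt_av h)
      · subst h
        rcases hj with hj | hj
        · exact absurd hj hyP
        · right; exact (tArc_norm hj).ge
      · right; exact (tlt_av h).trans (tpiece_norm hj).1
    have h0 := hs.1
    have h1 := hs.2
    rcases hy' with h | h
    · left
      rw [sub_zero, abs_of_nonneg h0]
      linarith
    · right
      rw [abs_sub_comm, abs_of_nonneg (by linarith)]
      linarith
  ord z r hr := by
    left
    have : Convex ℝ (tsegF k ⁻¹' ball z r) := by
      have h := (convex_ball z r).affine_preimage (AffineMap.lineMap (tsegF k 0) (tsegF k 1) : ℝ →ᵃ[ℝ] ℂ)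
      have e : tsegF k = (AffineMap.lineMap (tsegF k 0) (tsegF k 1) : ℝ →ᵃ[ℝ] ℂ) := by
        funext s
        simp [AffineMap.lineMap_apply, tsegF]
        ring
      rw [e]
      exact h
    exact ordConnected_Icc.inter this.ordConnected

lemma tarc_dist (k : ℕ) (s t : ℝ) :
    dist (tarcF k s) (tarcF k t) = 2 ^ k * |2 * Real.sin ((s / 2 ^ k - t / 2 ^ k) / 2)| := by
  rw [dist_eq_norm, tarcF, tarcF, ← mul_sub, norm_mul, Complex.norm_real, Real.norm_eq_abs, abs_mul,
    tsg_abs, one_mul, abs_of_nonneg (by positivity)]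
  congr 1
  have : Complex.exp (Complex.I * ((s / 2 ^ k : ℝ) : ℂ)) - Complex.exp (Complex.I * ((t / 2 ^ k : ℝ) : ℂ))
    = Complex.exp (Complex.I * ((t / 2 ^ k : ℝ) : ℂ)) *
      (Complex.exp (Complex.I * ((s / 2 ^ k - t / 2 ^ k : ℝ) : ℂ)) - 1) := by
    rw [mul_sub, ← Complex.exp_add]
    congr 2
    · push_cast; ring
    · ring
  rw [this, norm_mul, Complex.norm_exp_I_mul_ofReal, one_mul, Complex.norm_exp_I_mul_ofReal_sub_one,
    Real.norm_eq_abs]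

lemma tsin_conv {A B c a b d : ℝ} (ha : 0 ≤ a) (hab : a ≤ b) (hbd : b ≤ d) (hd : d ≤ π)
    (hc : 0 ≤ c) (h1 : c ≤ A * Real.cos a + B * Real.sin a)
    (h3 : c ≤ A * Real.cos d + B * Real.sin d) (hlt : 0 < Real.sin (d - a)) :
    c ≤ A * Real.cos b + B * Real.sin b := by
  have e : (A * Real.cos b + B * Real.sin b) * Real.sin (d - a) =
      (A * Real.cos a + B * Real.sin a) * Real.sin (d - b) +
      (A * Real.cos d + B * Real.sin d) * Real.sin (b - a) := by
    simp only [Real.sin_sub]; ring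
  have s1 : 0 ≤ Real.sin (d - b) := Real.sin_nonneg_of_nonneg_of_le_pi (by linarith) (by linarith)
  have s2 : 0 ≤ Real.sin (b - a) := Real.sin_nonneg_of_nonneg_of_le_pi (by linarith) (by linarith)
  have s3 : Real.sin (d - a) ≤ Real.sin (d - b) + Real.sin (b - a) := by
    rw [show d - a = (d - b) + (b - a) by ring, Real.sin_add]
    nlinarith [Real.cos_le_one (d - b), Real.cos_le_one (b - a)]
  nlinarith [mul_le_mul_of_nonneg_right h1 s1, mul_le_mul_of_nonneg_right h3 s2,
    mul_le_mul_of_nonneg_left s3 hc]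

lemma tsin_conv' {A B c a b d : ℝ} (ha : 0 ≤ a) (hab : a ≤ b) (hbd : b ≤ d) (hd : d ≤ π)
    (hc : 0 < c) (h1 : c ≤ A * Real.cos a + B * Real.sin a)
    (h3 : c ≤ A * Real.cos d + B * Real.sin d) :
    c ≤ A * Real.cos b + B * Real.sin b := by
  by_cases h0 : d - a = π
  · have e1 : a = 0 := by linarith
    have e2 : d = π := by linarith
    subst e1 e2
    simp at h1 h3
    linarith
  by_cases h0' : d - a = 0
  · rwa [show b = a by linarith]
  refine tsin_conv ha hab hbd hd hc.le h1 h3 (Real.sin_pos_of_pos_of_lt_pi ?_ ?_)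
  · exact lt_of_le_of_ne (by linarith) (Ne.symm h0')
  · exact lt_of_le_of_ne (by linarith) h0

lemma tarc_mem_ball (k : ℕ) (s : ℝ) (z : ℂ) (r : ℝ) (hr : 0 < r) :
    tarcF k s ∈ ball z r ↔ (2 ^ k) ^ 2 + z.re ^ 2 + z.im ^ 2 - r ^ 2 <
      (2 * tsg k * 2 ^ k * z.re) * Real.cos (s / 2 ^ k) +
      (2 * tsg k * 2 ^ k * z.im) * Real.sin (s / 2 ^ k) := by
  have e : dist (tarcF k s) z ^ 2 = (2 ^ k) ^ 2 + z.re ^ 2 + z.im ^ 2 -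
      ((2 * tsg k * 2 ^ k * z.re) * Real.cos (s / 2 ^ k) +
      (2 * tsg k * 2 ^ k * z.im) * Real.sin (s / 2 ^ k)) := by
    rw [dist_eq_norm, Complex.sq_norm, Complex.normSq_apply, tarcF, mul_comm Complex.I,
      Complex.exp_mul_I, ← Complex.ofReal_cos, ← Complex.ofReal_sin]
    simp only [Complex.sub_re, Complex.sub_im, Complex.re_ofReal_mul, Complex.im_ofReal_mul,
      Complex.add_re, Complex.add_im, Complex.ofReal_re, Complex.ofReal_im, Complex.mul_I_re,
      Complex.mul_I_im]
    have h1 := tsg_sq k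
    have h2 := Real.sin_sq_add_cos_sq (s / 2 ^ k)
    generalize tsg k = σ at *
    generalize Real.sin (s / 2 ^ k) = S at *
    generalize Real.cos (s / 2 ^ k) = C at *
    linear_combination ((2:ℝ) ^ k) ^ 2 * (S ^ 2 + C ^ 2) * h1 + ((2:ℝ) ^ k) ^ 2 * h2
  rw [mem_ball, ← sq_lt_sq₀ dist_nonneg hr.le, e]
  constructor <;> intro h <;> linarith

lemma tarc_ord (k : ℕ) (z : ℂ) (r : ℝ) (hr : 0 < r) :
    OrdConnected {s | s ∈ Icc 0 (π * 2 ^ k) ∧ tarcF k s ∈ ball z r} ∨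
    OrdConnected {s | s ∈ Icc 0 (π * 2 ^ k) ∧ tarcF k s ∉ ball z r} := by
  have h2 : (0:ℝ) < 2 ^ k := by positivity
  simp only [tarc_mem_ball k _ z r hr]
  generalize (2 ^ k) ^ 2 + z.re ^ 2 + z.im ^ 2 - r ^ 2 = c
  generalize 2 * tsg k * 2 ^ k * z.re = A
  generalize 2 * tsg k * 2 ^ k * z.im = B
  have key : ∀ s ∈ Icc 0 (π * 2 ^ k), 0 ≤ s / 2 ^ k ∧ s / 2 ^ k ≤ π := fun s hs =>
    ⟨div_nonneg hs.1 h2.le, by rw [div_le_iff₀ h2]; exact hs.2⟩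
  rcases le_or_gt 0 c with hc | hc
  · left
    refine ⟨fun a ha d hd b hb => ⟨⟨ha.1.1.trans hb.1, hb.2.trans hd.1.2⟩, ?_⟩⟩
    have h1 := lt_min ha.2 hd.2
    refine lt_of_lt_of_le h1 (tsin_conv' (key a ha.1).1 (by have := hb.1; gcongr)
      (by have := hb.2; gcongr) (key d hd.1).2
      (lt_of_le_of_lt hc h1) (min_le_left _ _) (min_le_right _ _))
  · right
    refine ⟨fun a ha d hd b hb => ⟨⟨ha.1.1.trans hb.1, hb.2.trans hd.1.2⟩, ?_⟩⟩
    have h1 := ha.2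
    have h3 := hd.2
    rw [not_lt] at h1 h3 ⊢
    have := tsin_conv' (A := -A) (B := -B) (c := -c) (key a ha.1).1 (by have := hb.1; gcongr)
      (by have := hb.2; gcongr) (key d hd.1).2 (by linarith) (by linarith) (by linarith)
      (b := b / 2 ^ k)
    linarith

lemma tseg_im {k : ℕ} {y : ℂ} (hy : y ∈ tSeg k) : y.im = 0 := by
  obtain ⟨s, hs, rfl⟩ := hy
  simp [tsegF]

lemma tarc_end0 (k : ℕ) : tarcF k 0 = ((tsg k * 2 ^ k : ℝ) : ℂ) := by simp [tarcF]
lemma tarc_end1 (k : ℕ) : tarcF k (π * 2 ^ k) = ((- (tsg k * 2 ^ k) : ℝ) : ℂ) := by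
  have : π * 2 ^ k / 2 ^ k = π := by field_simp
  rw [tarcF, this, mul_comm Complex.I, Complex.exp_pi_mul_I]; simp

lemma tdist_end (x : ℂ) (ρ : ℝ) (hx : ‖x‖ = |ρ|) (h : 0 ≤ ρ * x.re) :
    dist x (ρ : ℂ) ^ 2 ≤ 2 * x.im ^ 2 := by
  have e : x.re ^ 2 + x.im ^ 2 = ρ ^ 2 := by
    rw [← sq_abs ρ, ← hx, Complex.sq_norm, Complex.normSq_apply]; ring
  rw [dist_eq_norm, Complex.sq_norm, Complex.normSq_apply]
  simp only [Complex.sub_re, Complex.sub_im, Complex.ofReal_re, Complex.ofReal_im]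
  have : x.re ^ 2 ≤ ρ * x.re := by
    have h1 : x.re ^ 2 ≤ ρ ^ 2 := by nlinarith [sq_nonneg x.im]
    have h2 := sq_le_sq.1 h1
    rw [← abs_of_nonneg h, abs_mul, ← sq_abs, sq]
    exact mul_le_mul_of_nonneg_right h2 (abs_nonneg _)
  nlinarith

lemma tarc_good (k : ℕ) : TGood tX (tArc k) (π * 2 ^ k) (tarcF k) where
  img := rfl
  nonneg := by positivity
  lip s _ t _ := by
    have h2 : (0:ℝ) < 2 ^ k := by positivity
    rw [tarc_dist]
    have := Real.abs_sin_le_abs (x := (s / 2 ^ k - t / 2 ^ k) / 2)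
    rw [abs_mul, abs_two]
    have e : |s - t| = 2 ^ k * (2 * |(s / 2 ^ k - t / 2 ^ k) / 2|) := by
      rw [show (s / 2 ^ k - t / 2 ^ k) / 2 = (s - t) / (2 * 2 ^ k) by field_simp, abs_div,
        abs_of_pos (by positivity : (0:ℝ) < 2 * 2 ^ k)]
      field_simp
    rw [e]
    gcongr
  colip s hs t ht := by
    have h2 : (0:ℝ) < 2 ^ k := by positivity
    rw [tarc_dist]
    set u := (s / 2 ^ k - t / 2 ^ k) / 2 with hu
    have e0 : u = (s - t) / (2 * 2 ^ k) := by rw [hu]; field_simp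
    have e : |s - t| = 2 ^ k * (2 * |u|) := by
      rw [e0, abs_div, abs_of_pos (by positivity : (0:ℝ) < 2 * 2 ^ k)]
      field_simp
    have hle : |u| ≤ π / 2 := by
      have : |s - t| ≤ π * 2 ^ k := by
        rw [abs_le]; constructor <;> linarith [hs.1, hs.2, ht.1, ht.2]
      rw [e] at this
      have : (2:ℝ) ^ k * (2 * |u|) ≤ 2 ^ k * π := by linarith
      have := le_of_mul_le_mul_left this h2
      linarith
    have h3 := Real.mul_abs_le_abs_sin hle
    rw [e, abs_mul, abs_two]
    have h4 : |u| ≤ 2 * |Real.sin u| := by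
      have : 1 / 2 ≤ 2 / π := by
        rw [div_le_div_iff₀ two_pos Real.pi_pos]; linarith [Real.pi_le_four]
      nlinarith [abs_nonneg u]
    nlinarith
  sep s hs y hy hyP := by
    have h2 : (0:ℝ) < 2 ^ k := by positivity
    have hxn := tarc_norm k s
    rw [tarc_end0, tarc_end1]
    generalize tarcF k s = x at *
    have habs : |tsg k * 2 ^ k| = 2 ^ k := by rw [abs_mul, tsg_abs]; simp
    obtain ⟨j, hj⟩ := mem_iUnion.1 hy
    rcases hj with hj | hj
    · have him : |x.im| ≤ dist x y := by
        have := Complex.abs_im_le_norm (x - y)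
        rw [Complex.sub_im, tseg_im hj, sub_zero] at this
        rwa [dist_eq_norm]
      have fin : ∀ p : ℂ, dist x p ^ 2 ≤ 2 * x.im ^ 2 → dist x p ≤ 4 * dist x y := by
        intro p hp
        refine (sq_le_sq₀ dist_nonneg (by positivity)).1 ?_
        have : x.im ^ 2 ≤ dist x y ^ 2 := by
          rw [← sq_abs]; gcongr
        nlinarith
      rcases le_total 0 (tsg k * 2 ^ k * x.re) with h | h
      · left; exact fin _ (tdist_end x _ (by rw [hxn, habs]) h)
      · right; exact fin _ (tdist_end x _ (by rw [hxn, abs_neg, habs]) (by linarith))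
    · left
      have hjk : j ≠ k := by rintro rfl; exact hyP hj
      have hyn := tArc_norm hj
      have hd : |‖x‖ - ‖y‖| ≤ dist x y := by
        rw [dist_eq_norm]; exact abs_norm_sub_norm_le _ _
      rw [hxn, hyn, abs_le] at hd
      have h1 : (2:ℝ) ^ k ≤ 2 * dist x y := by
        rcases lt_or_gt_of_ne hjk with h | h
        · have : (2:ℝ) ^ (j + 1) ≤ 2 ^ k := pow_le_pow_right₀ one_le_two h
          rw [pow_succ] at this
          linarith
        · have : (2:ℝ) ^ (k + 1) ≤ 2 ^ j := pow_le_pow_right₀ one_le_two h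
          rw [pow_succ] at this
          linarith
      have h3 : dist x ((tsg k * 2 ^ k : ℝ) : ℂ) ≤ 2 ^ k + 2 ^ k := by
        rw [dist_eq_norm]
        refine (norm_sub_le _ _).trans ?_
        rw [hxn, Complex.norm_real, Real.norm_eq_abs, habs]
      linarith
  ord := tarc_ord k

lemma tseg_cont (k : ℕ) : Continuous (tsegF k) := by unfold tsegF; fun_prop
lemma tarc_cont (k : ℕ) : Continuous (tarcF k) := by unfold tarcF; fun_prop

lemma tseg_endl (k : ℕ) : tsegF (k + 1) 0 = tarcF k (π * 2 ^ k) := by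
  rw [tarc_end1, tsegF, tsg_succ, tav_succ]; simp
lemma tseg_endr (k : ℕ) : tsegF k (2 ^ k - tav k) = tarcF k 0 := by
  rw [tarc_end0, tsegF]; simp

lemma tpiece_conn (k : ℕ) : IsPreconnected (tSeg k ∪ tArc k) := by
  refine IsPreconnected.union (tarcF k 0) ?_ ?_ ?_ ?_
  · rw [← tseg_endr]
    exact mem_image_of_mem _ ⟨by linarith [tav_le k], le_rfl⟩
  · exact mem_image_of_mem _ ⟨le_rfl, by positivity⟩
  · exact isPreconnected_Icc.image _ (tseg_cont k).continuousOn
  · exact isPreconnected_Icc.image _ (tarc_cont k).continuousOn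

lemma tX_conn : IsPreconnected tX := by
  refine IsPreconnected.iUnion_of_chain tpiece_conn ?_
  intro k
  refine ⟨tarcF k (π * 2 ^ k), Or.inr (mem_image_of_mem _ ⟨by positivity, le_rfl⟩), Or.inl ?_⟩
  rw [Order.succ_eq_add_one, ← tseg_endl]
  exact mem_image_of_mem _ ⟨le_rfl, by linarith [tav_le (k + 1)]⟩

lemma tX_unbdd (z : ℂ) (M : ℝ) : ∃ y ∈ tX, M ≤ dist y z := by
  obtain ⟨k, hk⟩ := pow_unbounded_of_one_lt (M + ‖z‖) (one_lt_two (α := ℝ))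
  refine ⟨tarcF k 0, mem_iUnion.2 ⟨k, Or.inr (mem_image_of_mem _ ⟨le_rfl, by positivity⟩)⟩, ?_⟩
  rw [dist_eq_norm]
  have := norm_sub_norm_le (tarcF k 0) z
  rw [tarc_norm] at this
  linarith

lemma tX_lower (w : ℂ) (hw : w ∈ tX) (R : ℝ) :
    ENNReal.ofReal R ≤ μH[1] (tX ∩ ball w R) := by
  have hL : LipschitzOnWith 1 (fun x => dist x w) (tX ∩ ball w R) :=
    (LipschitzWith.dist_left w).lipschitzOnWith
  have h1 := hL.hausdorffMeasure_image_le (d := 1) zero_le_one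
  simp only [ENNReal.coe_one, ENNReal.rpow_one, one_mul, hausdorffMeasure_real] at h1
  refine le_trans ?_ h1
  have hsub : Ico 0 R ⊆ (fun x => dist x w) '' (tX ∩ ball w R) := by
    intro t ht
    obtain ⟨y, hy, hyR⟩ := tX_unbdd w R
    have hc : ContinuousOn (fun x => dist x w) tX := by fun_prop
    have := tX_conn.intermediate_value hw hy hc
    obtain ⟨x, hx, rfl⟩ := this ⟨by simpa using ht.1, (ht.2.le.trans hyR)⟩
    exact ⟨x, ⟨hx, ht.2⟩, rfl⟩
  calc _ = volume (Ico 0 R) := by simp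
    _ ≤ _ := measure_mono hsub

lemma tgeom {β R : ℝ} (hβ : 0 < β) (hR : 0 ≤ R) (N : ℕ) (hN : ∀ k < N, (2:ℝ) ^ k ≤ 4 * R) :
    ∑ k ∈ Finset.range N, ((2:ℝ) ^ k) ^ β ≤ (2 ^ β / (2 ^ β - 1)) * (4 * R) ^ β := by
  have hq : (1:ℝ) < 2 ^ β := Real.one_lt_rpow one_lt_two hβ
  have e : ∀ k : ℕ, ((2:ℝ) ^ k) ^ β = (2 ^ β) ^ k := fun k => by
    rw [← Real.rpow_natCast, ← Real.rpow_natCast, ← Real.rpow_mul, ← Real.rpow_mul, mul_comm] <;>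
    norm_num
  cases N with
  | zero =>
    simp only [Finset.range_zero, Finset.sum_empty]
    have : 0 < (2:ℝ) ^ β - 1 := by linarith
    positivity
  | succ n =>
    simp only [e]
    rw [geom_sum_eq hq.ne', div_mul_eq_mul_div]
    have : 0 < (2:ℝ) ^ β - 1 := by linarith
    gcongr
    have h1 : ((2:ℝ) ^ n) ^ β ≤ (4 * R) ^ β := by
      have := hN n (by simp)
      gcongr
    rw [e] at h1
    rw [pow_succ]
    nlinarith

lemma tav_two {k m : ℕ} {x w : ℂ} {R : ℝ} (hx : x ∈ tSeg k ∪ tArc k) (hw : w ∈ tSeg m ∪ tArc m)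
    (hxw : dist x w < R) : (2:ℝ) ^ k ≤ 4 * R ∨ k = m - 1 ∨ k = m ∨ k = m + 1 := by
  have hx := tpiece_norm hx
  have hw := tpiece_norm hw
  have hd : |‖x‖ - ‖w‖| ≤ dist x w := by
    rw [dist_eq_norm]; exact abs_norm_sub_norm_le _ _
  rw [abs_le] at hd
  by_cases h : k = m - 1 ∨ k = m ∨ k = m + 1
  · exact Or.inr h
  left
  rcases lt_or_ge k m with hkm | hkm
  · obtain ⟨i, rfl⟩ := Nat.exists_eq_add_of_lt hkm
    have hi : i ≠ 0 := by rintro rfl; simp at h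
    obtain ⟨j, rfl⟩ := Nat.exists_eq_succ_of_ne_zero hi
    have h1 : (2:ℝ) ^ (k + 1) ≤ 2 ^ (k + j.succ) := by
      gcongr
      · norm_num
      · omega
    rw [tav_succ] at hw
    rw [pow_succ] at h1
    have : (0:ℝ) < 2 ^ k := by positivity
    linarith
  · obtain ⟨i, rfl⟩ := Nat.exists_eq_add_of_le hkm
    have hi : 2 ≤ i := by
      by_contra hc
      have : i = 0 ∨ i = 1 := by omega
      rcases this with rfl | rfl <;> simp at h
    obtain ⟨j, rfl⟩ := Nat.exists_eq_add_of_le' hi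
    have h1 : (2:ℝ) ^ m ≤ 2 ^ (m + j) := by
      gcongr
      · norm_num
      · omega
    rw [show m + (j + 2) = m + j + 1 + 1 by ring, tav_succ, pow_succ] at hx
    rw [show m + (j + 2) = m + j + 1 + 1 by ring, pow_succ, pow_succ]
    linarith

lemma tinterp {a ε b α : ℝ} (ha : 0 ≤ a) (h1 : a ≤ ε) (h2 : a ≤ b) (hα : 0 ≤ α) (hα1 : α ≤ 1) :
    a ≤ ε ^ α * b ^ (1 - α) := by
  rcases ha.eq_or_lt with rfl | ha
  · exact mul_nonneg (Real.rpow_nonneg h1 _) (Real.rpow_nonneg h2 _)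
  calc a = a ^ α * a ^ (1 - α) := by rw [← Real.rpow_add ha]; simp
    _ ≤ _ := by
      have hε : 0 ≤ ε := ha.le.trans h1
      have h3 : 0 ≤ 1 - α := by linarith
      exact mul_le_mul (Real.rpow_le_rpow ha.le h1 hα) (Real.rpow_le_rpow ha.le h2 h3)
        (Real.rpow_nonneg ha.le _) (Real.rpow_nonneg hε _)

lemma tX_main (α : ℝ) (h0 : 0 < α) (h1 : α < 1) : ∃ C : ℝ≥0,
      ∀ z ∈ tX, ∀ r : ℝ, 0 < r → ∀ w ∈ tX, ∀ R : ℝ, 0 < R → R ≤ 2 * r →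
        ∀ ε : ℝ, 0 < ε →
          μH[1] (relLayer tX (ball z r) ε ∩ ball w R) ≤
            (C : ℝ≥0∞) * ENNReal.ofReal ((ε / R) ^ α) *
              μH[1] (tX ∩ ball w R) := by
  set β := 1 - α with hβ
  have hβ0 : 0 < β := by linarith
  have hq : (0:ℝ) < 2 ^ β - 1 := by linarith [Real.one_lt_rpow (one_lt_two (α := ℝ)) hβ0]
  set K : ℝ := 160 * ((2 ^ β / (2 ^ β - 1)) * 4 ^ β + 3) with hK
  have hK0 : 0 ≤ K := by positivity
  refine ⟨K.toNNReal, ?_⟩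
  intro z hz r hr w hw R hR _ ε hε
  obtain ⟨m, hm⟩ := mem_iUnion.1 hw
  set L := relLayer tX (ball z r) ε with hL
  have hLX : L ⊆ tX := by
    rintro x (hx | hx)
    · exact hx.1.1
    · exact hx.1.1
  -- bound for one piece
  have hpiece : ∀ k b, (b = R ∨ b = 2 ^ k) → μH[1] ((L ∩ ball w R) ∩ (tSeg k ∪ tArc k)) ≤
      ENNReal.ofReal (160 * (ε ^ α * b ^ β)) := by
    intro k b hb
    have hbp : 0 < b := by rcases hb with rfl | rfl <;> positivity
    have hle : μH[1] ((L ∩ ball w R) ∩ (tSeg k ∪ tArc k)) ≤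
        ENNReal.ofReal (160 * min ε b) := by
      rw [inter_union_distrib_left]
      refine (measure_union_le _ _).trans ?_
      rcases le_total ε b with h | h
      · rw [min_eq_left h]
        have e1 := (tseg_good k).layer hz hr (tX_unbdd z) hε
        have e2 := (tarc_good k).layer hz hr (tX_unbdd z) hε
        calc _ ≤ ENNReal.ofReal (80 * ε) + ENNReal.ofReal (80 * ε) := by
              gcongr
              · exact (measure_mono (by gcongr; exact inter_subset_left)).trans e1
              · exact (measure_mono (by gcongr; exact inter_subset_left)).trans e2
          _ = _ := by rw [← ENNReal.ofReal_add (by positivity) (by positivity)]; congr 1; ring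
      · rw [min_eq_right h]
        rcases hb with rfl | rfl
        · have e1 := (tseg_good k).ballm w b
          have e2 := (tarc_good k).ballm w b
          calc _ ≤ ENNReal.ofReal (8 * b) + ENNReal.ofReal (8 * b) := by
                gcongr
                · exact (measure_mono (show L ∩ ball w b ∩ tSeg k ⊆ tSeg k ∩ ball w b from
                    fun x hx => ⟨hx.2, hx.1.2⟩)).trans e1
                · exact (measure_mono (show L ∩ ball w b ∩ tArc k ⊆ tArc k ∩ ball w b from
                    fun x hx => ⟨hx.2, hx.1.2⟩)).trans e2
            _ ≤ _ := by
              rw [← ENNReal.ofReal_add (by positivity) (by positivity)]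
              apply ENNReal.ofReal_le_ofReal; linarith
        · have e1 := (tseg_good k).total
          have e2 := (tarc_good k).total
          calc _ ≤ ENNReal.ofReal (2 ^ k - tav k) + ENNReal.ofReal (π * 2 ^ k) := by
                gcongr
                · exact (measure_mono inter_subset_right).trans e1
                · exact (measure_mono inter_subset_right).trans e2
            _ ≤ _ := by
              rw [← ENNReal.ofReal_add (by linarith [tav_le k]) (by positivity)]
              apply ENNReal.ofReal_le_ofReal
              nlinarith [tav_nonneg k, Real.pi_le_four]
    refine hle.trans (ENNReal.ofReal_le_ofReal ?_)
    gcongr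
    exact tinterp (by positivity) (min_le_left _ _) (min_le_right _ _) h0.le h1.le
  obtain ⟨N, hN, hN'⟩ : ∃ N : ℕ, 4 * R < 2 ^ N ∧ ∀ k < N, (2:ℝ) ^ k ≤ 4 * R := by
    have hex : ∃ N : ℕ, 4 * R < (2:ℝ) ^ N := pow_unbounded_of_one_lt _ one_lt_two
    classical
    exact ⟨Nat.find hex, Nat.find_spec hex, fun k hk => not_lt.1 (Nat.find_min hex hk)⟩
  set Q : ℕ → Set ℂ := fun k => (L ∩ ball w R) ∩ (tSeg k ∪ tArc k) with hQ
  have hcover : L ∩ ball w R ⊆ (⋃ k ∈ Finset.range N, Q k) ∪ (Q (m - 1) ∪ (Q m ∪ Q (m + 1))) := by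
    rintro x hx
    obtain ⟨k, hk⟩ := mem_iUnion.1 (hLX hx.1)
    have hxQ : x ∈ Q k := ⟨hx, hk⟩
    rcases tav_two hk hm hx.2 with h | rfl | rfl | rfl
    · left
      refine mem_biUnion (x := k) ?_ hxQ
      simp only [Finset.coe_range, mem_Iio]
      by_contra hc
      have : (2:ℝ) ^ N ≤ 2 ^ k := pow_le_pow_right₀ one_le_two (not_lt.1 hc)
      linarith
    · exact Or.inr (Or.inl hxQ)
    · exact Or.inr (Or.inr (Or.inl hxQ))
    · exact Or.inr (Or.inr (Or.inr hxQ))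
  have hpos : 0 ≤ 160 * (ε ^ α * R ^ β) := by positivity
  have hsum : μH[1] (⋃ k ∈ Finset.range N, Q k) ≤
      ENNReal.ofReal (160 * (ε ^ α * ((2 ^ β / (2 ^ β - 1)) * (4 * R) ^ β))) := by
    calc _ ≤ ∑ k ∈ Finset.range N, μH[1] (Q k) := measure_biUnion_finset_le _ _
      _ ≤ ∑ k ∈ Finset.range N, ENNReal.ofReal (160 * (ε ^ α * (2 ^ k) ^ β)) :=
        Finset.sum_le_sum fun k _ => hpiece k _ (Or.inr rfl)
      _ = ENNReal.ofReal (∑ k ∈ Finset.range N, 160 * (ε ^ α * (2 ^ k) ^ β)) := by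
        rw [ENNReal.ofReal_sum_of_nonneg]; intros; positivity
      _ ≤ _ := by
        apply ENNReal.ofReal_le_ofReal
        rw [← Finset.mul_sum, ← Finset.mul_sum]
        gcongr
        exact tgeom hβ0 hR.le N hN'
  calc μH[1] (L ∩ ball w R)
      ≤ μH[1] (⋃ k ∈ Finset.range N, Q k) + (μH[1] (Q (m - 1)) + (μH[1] (Q m) + μH[1] (Q (m + 1)))) := by
        refine (measure_mono hcover).trans ((measure_union_le _ _).trans ?_)
        gcongr
        refine (measure_union_le _ _).trans ?_
        gcongr
        exact measure_union_le _ _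
    _ ≤ ENNReal.ofReal (160 * (ε ^ α * ((2 ^ β / (2 ^ β - 1)) * (4 * R) ^ β))) +
        (ENNReal.ofReal (160 * (ε ^ α * R ^ β)) + (ENNReal.ofReal (160 * (ε ^ α * R ^ β)) +
        ENNReal.ofReal (160 * (ε ^ α * R ^ β)))) := by
        gcongr
        · exact hpiece _ _ (Or.inl rfl)
        · exact hpiece _ _ (Or.inl rfl)
        · exact hpiece _ _ (Or.inl rfl)
    _ = ENNReal.ofReal (K * (ε / R) ^ α * R) := by
        rw [← ENNReal.ofReal_add hpos hpos, ← ENNReal.ofReal_add hpos (by positivity),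
          ← ENNReal.ofReal_add (by positivity) (by positivity)]
        congr 1
        have e : R ^ β * R ^ α = R := by rw [← Real.rpow_add hR, hβ]; simp
        rw [Real.div_rpow hε.le hR.le, Real.mul_rpow (by norm_num) hR.le, hK]
        have hRα : 0 < R ^ α := by positivity
        have e2 : ε ^ α / R ^ α * R = ε ^ α * R ^ β := by
          rw [div_mul_eq_mul_div, div_eq_iff hRα.ne', mul_assoc, e]
        rw [mul_assoc _ _ R, e2]
        ring
    _ = ENNReal.ofReal K * ENNReal.ofReal ((ε / R) ^ α) * ENNReal.ofReal R := by
        rw [ENNReal.ofReal_mul (by positivity), ENNReal.ofReal_mul hK0]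
    _ ≤ _ := by
        have := tX_lower w hw R
        change _ ≤ ENNReal.ofReal K * _ * _
        gcongr

lemma tcurve_eq (γ : ℝ → ℂ)
    (hseg0 : ∀ t ∈ Set.Icc (0 : ℝ) 1, γ t = (t : ℂ))
    (harc0 : ∀ t ∈ Set.Icc (1 : ℝ) (1 + π),
      γ t = Complex.exp (Complex.I * ((t : ℂ) - 1)))
    (hseg : ∀ k : ℕ, 1 ≤ k →
      ∀ t ∈ Set.Icc (-π + (1 + 2 * π) * 2 ^ (k - 1)) (-π + (2 + 2 * π) * 2 ^ (k - 1)),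
        γ t = (if Even k then 1 else -1) *
          ((2 : ℂ) ^ (k - 1) + ((t : ℂ) - ((-π + (1 + 2 * π) * 2 ^ (k - 1) : ℝ) : ℂ))))
    (harc : ∀ k : ℕ, 1 ≤ k →
      ∀ t ∈ Set.Icc (-π + (2 + 2 * π) * 2 ^ (k - 1)) (-π + (1 + 2 * π) * 2 ^ k),
        γ t = (if Even k then 1 else -1) * (2 : ℂ) ^ k *
          Complex.exp (Complex.I *
            (((t : ℂ) - ((-π + (2 + 2 * π) * 2 ^ (k - 1) : ℝ) : ℂ)) / (2 : ℂ) ^ k))) :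
    curveSet γ = tX := by
  have hpi := Real.pi_pos
  have es : ∀ k : ℕ, ((tsg k : ℝ) : ℂ) = if Even k then 1 else -1 := by
    intro k; unfold tsg; split_ifs <;> simp
  -- uniform description, with start times
  obtain ⟨u, v, hu0, huv, hvu, hS, hA⟩ : ∃ u v : ℕ → ℝ, u 0 = 0 ∧ (∀ k, v k = u k + (2 ^ k - tav k)) ∧
      (∀ k, u (k + 1) = v k + π * 2 ^ k) ∧
      (∀ k, ∀ t ∈ Icc (u k) (v k), γ t = tsegF k (t - u k)) ∧
      (∀ k, ∀ t ∈ Icc (v k) (u (k + 1)), γ t = tarcF k (t - v k)) := by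
    refine ⟨fun k => if k = 0 then 0 else -π + (1 + 2 * π) * 2 ^ (k - 1),
      fun k => if k = 0 then 1 else -π + (2 + 2 * π) * 2 ^ (k - 1), by simp, ?_, ?_, ?_, ?_⟩
    · rintro (_ | k)
      · simp [tav]
      · simp [tav, pow_succ]; ring
    · rintro (_ | k)
      · simp; ring
      · simp [pow_succ]; ring
    · rintro (_ | k) t ht
      · simp at ht
        rw [hseg0 t ht]
        simp [tsegF, tsg, tav]
      · simp only [Nat.add_eq_zero_iff, one_ne_zero, and_false, if_false] at ht ⊢
        rw [hseg (k + 1) (by omega) t ht, tsegF, Complex.ofReal_mul, es]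
        simp [tav]
    · rintro (_ | k) t ht
      · simp at ht
        rw [harc0 t ⟨ht.1, by linarith [ht.2]⟩]
        simp [tarcF, tsg]
      · simp only [Nat.add_eq_zero_iff, one_ne_zero, and_false, if_false] at ht ⊢
        rw [harc (k + 1) (by omega) t ht, tarcF, Complex.ofReal_mul, es]
        simp
  have hv : ∀ k, u k ≤ v k := fun k => by rw [huv]; linarith [tav_le k]
  have hu : ∀ k, v k ≤ u (k + 1) := fun k => by
    rw [hvu]; have : 0 ≤ π * 2 ^ k := by positivity
    linarith
  have hupos : ∀ k, 0 ≤ u k := by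
    intro k
    induction k with
    | zero => exact hu0.ge
    | succ k ih => exact ih.trans ((hv k).trans (hu k))
  have hubig : ∀ k : ℕ, (k : ℝ) ≤ u k := by
    intro k
    induction k with
    | zero => simp [hu0]
    | succ k ih =>
      have h1 := hv k
      have h2 := hvu k
      have h3 : (1:ℝ) ≤ 2 ^ k := one_le_pow₀ one_le_two
      have h4 := Real.pi_gt_three
      push_cast
      nlinarith
  apply Subset.antisymm
  · rintro _ ⟨t, ht, rfl⟩
    have hex : ∃ k : ℕ, t ≤ u (k + 1) := by
      obtain ⟨k, hk⟩ := exists_nat_ge t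
      exact ⟨k, hk.trans ((hubig k).trans ((hv k).trans (hu k)))⟩
    classical
    obtain ⟨k, hk1, hk2⟩ : ∃ k, u k ≤ t ∧ t ≤ u (k + 1) := by
      refine ⟨Nat.find hex, ?_, Nat.find_spec hex⟩
      rcases h : Nat.find hex with _ | j
      · rw [hu0]; exact ht
      · have := Nat.find_min hex (m := j) (by omega)
        exact (not_le.1 this).le
    refine mem_iUnion.2 ⟨k, ?_⟩
    rcases le_total t (v k) with h | h
    · left
      rw [hS k t ⟨hk1, h⟩]
      exact mem_image_of_mem _ ⟨by linarith, by linarith [huv k]⟩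
    · right
      rw [hA k t ⟨h, hk2⟩]
      exact mem_image_of_mem _ ⟨by linarith, by linarith [hvu k]⟩
  · refine iUnion_subset fun k => ?_
    rintro _ (⟨s, hs, rfl⟩ | ⟨s, hs, rfl⟩)
    · refine ⟨u k + s, ?_, ?_⟩
      · exact add_nonneg (hupos k) hs.1
      · rw [hS k _ ⟨by linarith [hs.1], by linarith [hs.2, huv k]⟩]; simp
    · refine ⟨v k + s, ?_, ?_⟩
      · exact add_nonneg ((hupos k).trans (hv k)) hs.1
      · rw [hA k _ ⟨by linarith [hs.1], by linarith [hs.2, hvu k]⟩]; simp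

/-- the Tessera curve space `(X_T, d, Λ)` satisfies the relative layer
decay property (RLD), for every exponent `0 < α < 1`. -/
theorem tessera_relLayerDecay
    (γ : ℝ → ℂ)
    (hseg0 : ∀ t ∈ Set.Icc (0 : ℝ) 1, γ t = (t : ℂ))
    (harc0 : ∀ t ∈ Set.Icc (1 : ℝ) (1 + π),
      γ t = Complex.exp (Complex.I * ((t : ℂ) - 1)))
    (hseg : ∀ k : ℕ, 1 ≤ k →
      ∀ t ∈ Set.Icc (-π + (1 + 2 * π) * 2 ^ (k - 1)) (-π + (2 + 2 * π) * 2 ^ (k - 1)),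
        γ t = (if Even k then 1 else -1) *
          ((2 : ℂ) ^ (k - 1) + ((t : ℂ) - ((-π + (1 + 2 * π) * 2 ^ (k - 1) : ℝ) : ℂ))))
    (harc : ∀ k : ℕ, 1 ≤ k →
      ∀ t ∈ Set.Icc (-π + (2 + 2 * π) * 2 ^ (k - 1)) (-π + (1 + 2 * π) * 2 ^ k),
        γ t = (if Even k then 1 else -1) * (2 : ℂ) ^ k *
          Complex.exp (Complex.I *
            (((t : ℂ) - ((-π + (2 + 2 * π) * 2 ^ (k - 1) : ℝ) : ℂ)) / (2 : ℂ) ^ k))) :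
    ∀ α : ℝ, 0 < α → α < 1 → ∃ C : ℝ≥0,
      ∀ z ∈ curveSet γ, ∀ r : ℝ, 0 < r → ∀ w ∈ curveSet γ, ∀ R : ℝ, 0 < R → R ≤ 2 * r →
        ∀ ε : ℝ, 0 < ε →
          μH[1] (relLayer (curveSet γ) (ball z r) ε ∩ ball w R) ≤
            (C : ℝ≥0∞) * ENNReal.ofReal ((ε / R) ^ α) *
              μH[1] (curveSet γ ∩ ball w R) := by
  rw [tcurve_eq γ hseg0 harc0 hseg harc]
  exact tX_main
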